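/- Let A be a connected component of C with A ∩ C₀ = ∅, and suppose A is a local maximum for H in the sense that there is a set 𝒩, relatively open in Δ with A ⊆ 𝒩, such that H(v) < H(p) for every v ∈ 𝒩 \ A and every p ∈ A. Then P(dist(V(n), A) → 0 as n → ∞) > 0, where dist denotes Euclidean distance from a point to a set. -/

import Mathlib

open MeasureTheory Filter Finset

namespace VRRW

noncomputable def simplex (d : ℕ) : Set (Fin d → ℝ) :=
  {v | (∀ i, 0 ≤ v i) ∧ ∑ i, v i = 1}

noncomputable def Nvec {d : ℕ} (R : Matrix (Fin d) (Fin d) ℝ) (v : Fin d → ℝ) (i : Fin d) : ℝ :=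
  ∑ j, R i j * v j

noncomputable def Hfun {d : ℕ} (R : Matrix (Fin d) (Fin d) ℝ) (v : Fin d → ℝ) : ℝ :=
  ∑ i, ∑ j, R i j * v i * v j

noncomputable def piVec {d : ℕ} (R : Matrix (Fin d) (Fin d) ℝ) (v : Fin d → ℝ) : Fin d → ℝ :=
  fun i => v i * Nvec R v i / Hfun R v

noncomputable def Mmat {d : ℕ} (R : Matrix (Fin d) (Fin d) ℝ) (v : Fin d → ℝ) :
    Matrix (Fin d) (Fin d) ℝ :=
  fun i j => R i j * v j / Nvec R v i

noncomputable def critSet {d : ℕ} (R : Matrix (Fin d) (Fin d) ℝ) : Set (Fin d → ℝ) :=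
  {v | v ∈ simplex d ∧ 0 < Hfun R v ∧ piVec R v = v}

noncomputable def degenSet {d : ℕ} (R : Matrix (Fin d) (Fin d) ℝ) : Set (Fin d → ℝ) :=
  {v | v ∈ simplex d ∧ ((∃ i, Nvec R v i = 0) ∨ ∃ i j, ∀ k, 1 ≤ k → (Mmat R v ^ k) i j = 0)}

/-- `S_i(n)`: one plus the number of visits to state `i` strictly after time `d`, up to time `n`. -/
noncomputable def visits {d : ℕ} {Ω : Type*} (Y : ℕ → Ω → Fin d) (n : ℕ) (ω : Ω) (i : Fin d) : ℝ :=
  1 + (((Finset.Ioc d n).filter fun m => Y m ω = i).card : ℝ)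

/-- `V(n) = S(n)/n`, the fractional occupation vector. -/
noncomputable def occup {d : ℕ} {Ω : Type*} (Y : ℕ → Ω → Fin d) (n : ℕ) (ω : Ω) : Fin d → ℝ :=
  fun i => visits Y n ω i / n

/-- The natural filtration `F_n = σ(Y_d, …, Y_n)`. -/
def natFilt {d : ℕ} {Ω : Type*} (Y : ℕ → Ω → Fin d) (n : ℕ) : MeasurableSpace Ω :=
  ⨆ m ∈ Finset.Icc d n, MeasurableSpace.comap (Y m) ⊤

/-- The defining properties of the vertex-reinforced random walk driven by `R`:
measurability, start `Y_d = 1` (state `1` is encoded as index `0` of `Fin d`), and the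
reinforced transition probabilities, expressed via conditional expectation of indicators. -/
def IsVRRW {d : ℕ} {Ω : Type*} [MeasurableSpace Ω] (μ : Measure Ω)
    (R : Matrix (Fin d) (Fin d) ℝ) (Y : ℕ → Ω → Fin d) : Prop :=
  (∀ n, Measurable (Y n)) ∧
  (∀ ω, (Y d ω : ℕ) = 0) ∧
  (∀ n, d ≤ n → ∀ j : Fin d,
    (μ[(fun ω => if Y (n + 1) ω = j then (1 : ℝ) else 0) | natFilt Y n])
      =ᵐ[μ] fun ω => R (Y n ω) j * visits Y n ω j / ∑ i, R (Y n ω) i * visits Y n ω i)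

/-- Euclidean distance from a point to a set: `inf {|x − y| : y ∈ A}`. -/
noncomputable def distToSet {d : ℕ} (x : Fin d → ℝ) (A : Set (Fin d → ℝ)) : ℝ :=
  sInf ((fun y => Real.sqrt (∑ i, (x i - y i) ^ 2)) '' A)

end VRRW

open VRRW MeasureTheory Filter

namespace VRRW

variable {d : ℕ} {R : Matrix (Fin d) (Fin d) ℝ}

lemma Hfun_eq_sum (v : Fin d → ℝ) : Hfun R v = ∑ i, v i * Nvec R v i := by
  simp only [Hfun, Nvec, Finset.mul_sum]
  exact Finset.sum_congr rfl fun i _ => Finset.sum_congr rfl fun j _ => by ring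

lemma Nvec_add (v u : Fin d → ℝ) (i : Fin d) : Nvec R (v + u) i = Nvec R v i + Nvec R u i := by
  simp only [Nvec, Pi.add_apply, mul_add, Finset.sum_add_distrib]

lemma Nvec_smul (t : ℝ) (u : Fin d → ℝ) (i : Fin d) : Nvec R (t • u) i = t * Nvec R u i := by
  simp only [Nvec, Pi.smul_apply, smul_eq_mul, Finset.mul_sum]
  exact Finset.sum_congr rfl fun j _ => by ring

lemma Hfun_smul (t : ℝ) (u : Fin d → ℝ) : Hfun R (t • u) = t ^ 2 * Hfun R u := by
  simp only [Hfun_eq_sum, Nvec_smul, Pi.smul_apply, smul_eq_mul, Finset.mul_sum]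
  exact Finset.sum_congr rfl fun j _ => by ring

lemma sum_mul_Nvec_comm (hsymm : R.IsSymm) (v u : Fin d → ℝ) :
    ∑ i, v i * Nvec R u i = ∑ i, u i * Nvec R v i := by
  simp only [Nvec, Finset.mul_sum]
  rw [Finset.sum_comm]
  refine Finset.sum_congr rfl fun i _ => Finset.sum_congr rfl fun j _ => ?_
  rw [hsymm.apply i j]
  ring

lemma Hfun_add (hsymm : R.IsSymm) (v u : Fin d → ℝ) :
    Hfun R (v + u) = Hfun R v + 2 * ∑ i, u i * Nvec R v i + Hfun R u := by
  have h := sum_mul_Nvec_comm hsymm v u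
  simp only [Hfun_eq_sum, Nvec_add, Pi.add_apply, mul_add, add_mul, Finset.sum_add_distrib] at h ⊢
  linarith

lemma Nvec_single (j i : Fin d) : Nvec R (Pi.single j 1) i = R i j := by
  simp [Nvec, Pi.single_apply]

lemma mem_degenSet_of_coord_eq_zero {v : Fin d → ℝ} (hv : v ∈ simplex d) {j : Fin d}
    (hj : v j = 0) : v ∈ degenSet R := by
  refine ⟨hv, Or.inr ⟨j, j, fun k hk => ?_⟩⟩
  obtain ⟨k, rfl⟩ := Nat.exists_eq_add_of_le' hk
  rw [pow_succ, Matrix.mul_apply]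
  refine Finset.sum_eq_zero fun l _ => ?_
  simp [Mmat, hj]

lemma mem_critSet_of_Nvec_eq {v : Fin d → ℝ} (hv : v ∈ simplex d) {c : ℝ} (hc : 0 < c)
    (h : ∀ i, Nvec R v i = c) : v ∈ critSet R := by
  have hH : Hfun R v = c := by
    rw [Hfun_eq_sum]
    simp only [h, ← Finset.sum_mul, hv.2, one_mul]
  refine ⟨hv, hH ▸ hc, ?_⟩
  ext i
  rw [piVec, h, hH, mul_div_cancel_right₀ _ hc.ne']

/-- A critical point with positive coordinates is an equaliser of `Nvec`. -/
lemma Nvec_eq_Hfun_of_mem_critSet {v : Fin d → ℝ} (hv : v ∈ critSet R) (hpos : ∀ i, 0 < v i)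
    (i : Fin d) : Nvec R v i = Hfun R v := by
  have h := congrFun hv.2.2 i
  rw [piVec, div_eq_iff hv.2.1.ne'] at h
  exact mul_left_cancel₀ (hpos i).ne' h

lemma sum_col_le_Nvec (hsymm : R.IsSymm) (hnonneg : ∀ i j, 0 ≤ R i j)
    {S : Fin d → ℝ} (hS : ∀ i, 1 ≤ S i) (i : Fin d) : ∑ j, R j i ≤ Nvec R S i := by
  refine Finset.sum_le_sum fun j _ => ?_
  rw [hsymm.apply i j]
  nlinarith [hnonneg i j, hS j]

/-- An interior ray from an interior point of the simplex leaves it through a boundary point. -/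
lemma exists_boundary_point {x u : Fin d → ℝ} (hx : x ∈ simplex d) (hpos : ∀ i, 0 < x i)
    (hsum : ∑ i, u i = 0) (hu : u ≠ 0) :
    ∃ T : ℝ, 0 < T ∧ (∀ t ∈ Set.Icc 0 T, x + t • u ∈ simplex d) ∧ ∃ j, (x + T • u) j = 0 := by
  have hneg : ∃ i, u i < 0 := by
    by_contra! h
    exact hu (funext fun i => (Finset.sum_eq_zero_iff_of_nonneg fun i _ => h i).1 hsum i (by simp))
  have hne : (Finset.univ.filter fun i => u i < 0).Nonempty := by
    obtain ⟨i, hi⟩ := hneg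
    exact ⟨i, by simpa using hi⟩
  obtain ⟨j, hj, hmin⟩ := Finset.exists_min_image _ (fun i => x i / -u i) hne
  have hj' : 0 < -u j := by simpa using hj
  refine ⟨x j / -u j, div_pos (hpos j) hj', fun t ht => ⟨fun i => ?_, ?_⟩, j, ?_⟩
  · simp only [Pi.add_apply, Pi.smul_apply, smul_eq_mul]
    by_cases hi : u i < 0
    · have h := ht.2.trans (hmin i (by simpa using hi))
      rw [le_div_iff₀ (by linarith)] at h
      linarith
    · nlinarith [hpos i, ht.1, not_lt.1 hi]
  · simp [Finset.sum_add_distrib, ← Finset.mul_sum, hsum, hx.2]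
  · have : u j ≠ 0 := by linarith
    simp only [Pi.add_apply, Pi.smul_apply, smul_eq_mul]
    field_simp
    ring

/-- At an interior local maximum of `H` forming a component of `C` away from the degeneracy set,
`R` is negative definite on the tangent space of the simplex. -/
lemma Hfun_neg_of_sum_eq_zero (hsymm : R.IsSymm) {A 𝒩 : Set (Fin d → ℝ)} {x : Fin d → ℝ}
    (hx : x ∈ critSet R) (hA : A = connectedComponentIn (critSet R) x)
    (hdisj : A ∩ degenSet R = ∅)
    (hopen : ∃ U : Set (Fin d → ℝ), IsOpen U ∧ 𝒩 = U ∩ simplex d) (hsub : A ⊆ 𝒩)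
    (hmax : ∀ v ∈ 𝒩 \ A, ∀ p ∈ A, Hfun R v < Hfun R p) (hpos : ∀ i, 0 < x i)
    {u : Fin d → ℝ} (hsum : ∑ i, u i = 0) (hu : u ≠ 0) : Hfun R u < 0 := by
  by_contra! hH
  have hxA : x ∈ A := hA ▸ mem_connectedComponentIn hx
  have hxN := Nvec_eq_Hfun_of_mem_critSet hx hpos
  have hcross : ∑ i, u i * Nvec R x i = 0 := by
    simp only [hxN, ← Finset.sum_mul, hsum, zero_mul]
  obtain ⟨T, hT, hmem, j, hj⟩ := exists_boundary_point hx.1 hpos hsum hu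
  obtain ⟨U, hU, rfl⟩ := hopen
  have hcont : Continuous fun t : ℝ => x + t • u := by fun_prop
  have hev : ∀ᶠ t in nhdsWithin (0 : ℝ) (Set.Ioi 0),
      x + t • u ∈ U ∧ (∀ i, 0 < (x + t • u) i) ∧ t ∈ Set.Ioc 0 T := by
    have h1 : ∀ᶠ t in nhds (0 : ℝ), x + t • u ∈ U :=
      hcont.continuousAt.eventually_mem (hU.mem_nhds (by simpa using (hsub hxA).1))
    have h2 : ∀ᶠ t in nhds (0 : ℝ), ∀ i, 0 < (x + t • u) i := by
      refine Filter.eventually_all.2 fun i => ?_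
      have hc : Continuous fun t : ℝ => (x + t • u) i := (continuous_apply i).comp hcont
      exact hc.continuousAt.eventually_const_lt (by simpa using hpos i)
    exact (h1.filter_mono nhdsWithin_le_nhds).and
      ((h2.filter_mono nhdsWithin_le_nhds).and (Ioc_mem_nhdsGT hT))
  obtain ⟨t, htU, htpos, ht0, htT⟩ := hev.exists
  have htA : x + t • u ∈ A := by
    by_contra hn
    have h := hmax _ ⟨⟨htU, hmem t ⟨ht0.le, htT⟩⟩, hn⟩ x hxA
    rw [Hfun_add hsymm, Hfun_smul] at h
    simp only [Pi.smul_apply, smul_eq_mul, mul_assoc, ← Finset.mul_sum, hcross] at h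
    nlinarith [sq_nonneg t]
  have htN := Nvec_eq_Hfun_of_mem_critSet (connectedComponentIn_subset _ _ (hA ▸ htA)) htpos
  have huN : ∀ i, Nvec R u i = (Hfun R (x + t • u) - Hfun R x) / t := fun i => by
    rw [eq_div_iff ht0.ne', ← htN i, Nvec_add, Nvec_smul, hxN]
    ring
  have hzero : (Hfun R (x + t • u) - Hfun R x) / t = 0 := by
    have h := sum_mul_Nvec_comm hsymm x u
    rw [hcross] at h
    simpa only [huN, ← Finset.sum_mul, hx.1.2, one_mul] using h
  have hsegment : (fun s : ℝ => x + s • u) '' Set.Icc 0 T ⊆ critSet R := by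
    rintro _ ⟨s, hs, rfl⟩
    refine mem_critSet_of_Nvec_eq (hmem s hs) hx.2.1 fun i => ?_
    rw [Nvec_add, Nvec_smul, huN, hzero, hxN]
    ring
  have hTA : x + T • u ∈ A := by
    rw [hA]
    exact (isPreconnected_Icc.image _ hcont.continuousOn).subset_connectedComponentIn
      ⟨0, ⟨le_rfl, hT.le⟩, by simp⟩ hsegment ⟨T, ⟨hT.le, le_rfl⟩, rfl⟩
  exact (Set.eq_empty_iff_forall_notMem.1 hdisj _)
    ⟨hTA, mem_degenSet_of_coord_eq_zero (hmem T ⟨hT.le, le_rfl⟩) hj⟩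

lemma isCompact_simplex : IsCompact (simplex d) := isCompact_stdSimplex ℝ (Fin d)

lemma continuous_Hfun : Continuous (Hfun R) := by
  unfold Hfun
  fun_prop

/-- A sequence in the simplex maximising `H` converges to the maximiser, if that is unique. -/
lemma tendsto_of_tendsto_Hfun {x : Fin d → ℝ} (hx : ∀ v ∈ simplex d, v ≠ x → Hfun R v < Hfun R x)
    {v : ℕ → Fin d → ℝ} (hv : ∀ᶠ n in atTop, v n ∈ simplex d)
    (hlim : Tendsto (fun n => Hfun R (v n)) atTop (nhds (Hfun R x))) :
    Tendsto v atTop (nhds x) := by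
  refine isCompact_simplex.tendsto_nhds_of_unique_mapClusterPt hv fun y hy hcl => ?_
  by_contra hne
  have h := hcl.tendsto_comp (continuous_Hfun (R := R)).continuousAt
  obtain ⟨φ, hφ⟩ := mapClusterPt_iff_ultrafilter.1 h
  exact (hx y hy hne).ne (tendsto_nhds_unique hφ.2 (hlim.mono_left hφ.1))

lemma tendsto_distToSet {A : Set (Fin d → ℝ)} {x : Fin d → ℝ} (hx : x ∈ A) {v : ℕ → Fin d → ℝ}
    (hv : Tendsto v atTop (nhds x)) : Tendsto (fun n => distToSet (v n) A) atTop (nhds 0) := by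
  have hc : Continuous fun w : Fin d → ℝ => Real.sqrt (∑ i, (w i - x i) ^ 2) := by fun_prop
  have h := (hc.tendsto x).comp hv
  simp only [sub_self, ne_eq, OfNat.ofNat_ne_zero, not_false_eq_true, zero_pow,
    Finset.sum_const_zero, Real.sqrt_zero] at h
  have hnn (w : Fin d → ℝ) :
      ∀ b ∈ (fun y => Real.sqrt (∑ i, (w i - y i) ^ 2)) '' A, 0 ≤ b := by
    rintro _ ⟨y, _, rfl⟩
    exact Real.sqrt_nonneg _
  exact squeeze_zero (fun n => Real.sInf_nonneg (hnn _))
    (fun n => csInf_le ⟨0, hnn _⟩ ⟨x, hx, rfl⟩) h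

/-- A nonnegative sequence whose increments are dominated by non-summable, square-summable weights
and whose weighted sum converges tends to zero. -/
lemma tendsto_zero_of_summable_mul {a w : ℕ → ℝ} {K : ℝ} (ha : ∀ k, 0 ≤ a k) (hw : ∀ k, 0 ≤ w k)
    (hinc : ∀ k, |a (k + 1) - a k| ≤ K * w k) (hsum : Summable fun k => a k * w k)
    (hw2 : Summable fun k => w k ^ 2) (hw1 : ¬ Summable w) : Tendsto a atTop (nhds 0) := by
  have hsq : Summable fun k => dist (a k ^ 2) (a k.succ ^ 2) := by
    refine Summable.of_nonneg_of_le (fun k => dist_nonneg) (fun k => ?_)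
      ((hsum.mul_left (2 * K)).add (hw2.mul_left (K ^ 2)))
    have h := hinc k
    have hle : |a (k + 1) + a k| ≤ 2 * a k + K * w k := by
      rw [abs_of_nonneg (add_nonneg (ha _) (ha _))]
      linarith [(abs_le.1 h).2]
    rw [dist_comm, Real.dist_eq, Nat.succ_eq_add_one]
    calc |a (k + 1) ^ 2 - a k ^ 2| = |a (k + 1) - a k| * |a (k + 1) + a k| := by
          rw [← abs_mul]; ring_nf
      _ ≤ K * w k * (2 * a k + K * w k) :=
          mul_le_mul h hle (abs_nonneg _) ((abs_nonneg _).trans h)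
      _ = 2 * K * (a k * w k) + K ^ 2 * w k ^ 2 := by ring
  obtain ⟨l, hl⟩ := cauchySeq_tendsto_of_complete (cauchySeq_of_summable_dist hsq)
  have hl' : Tendsto a atTop (nhds (√l)) := by
    refine ((Real.continuous_sqrt.tendsto l).comp hl).congr fun k => ?_
    exact Real.sqrt_sq (ha k)
  rcases (Real.sqrt_nonneg l).eq_or_lt with h | h
  · rwa [← h] at hl'
  · refine absurd ?_ hw1
    obtain ⟨k₀, hk₀⟩ := eventually_atTop.1 (hl'.eventually_const_lt (half_lt_self h))
    rw [← summable_nat_add_iff k₀] at hsum ⊢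
    refine Summable.of_nonneg_of_le (fun k => hw _) (fun k => ?_) (hsum.mul_left (2 / √l))
    have h2 : √l / 2 * w (k + k₀) ≤ a (k + k₀) * w (k + k₀) :=
      mul_le_mul_of_nonneg_right (hk₀ _ (by lia)).le (hw _)
    calc w (k + k₀) = 2 / √l * (√l / 2 * w (k + k₀)) := by field_simp
      _ ≤ _ := mul_le_mul_of_nonneg_left h2 (by positivity)

/-- The quadratic form `H` with a diagonal correction that makes its increments along the walk
exactly twice `Nvec` at the new state. -/
noncomputable def Hplus (R : Matrix (Fin d) (Fin d) ℝ) (S : Fin d → ℝ) : ℝ :=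
  Hfun R S + ∑ i, R i i * S i

lemma Hplus_add_single (hsymm : R.IsSymm) (S : Fin d → ℝ) (j : Fin d) :
    Hplus R (S + Pi.single j 1) = Hplus R S + 2 * Nvec R (S + Pi.single j 1) j := by
  have h1 : Hfun R (Pi.single j 1) = R j j := by
    simp [Hfun_eq_sum, Nvec_single, Pi.single_apply]
  have h2 : ∑ i, (Pi.single j 1 : Fin d → ℝ) i * Nvec R S i = Nvec R S j := by
    simp [Pi.single_apply]
  have h3 : ∑ i, R i i * (S + Pi.single j 1 : Fin d → ℝ) i = ∑ i, R i i * S i + R j j := by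
    simp [mul_add, Finset.sum_add_distrib, Pi.single_apply]
  rw [Hplus, Hplus, Hfun_add hsymm, h1, h2, h3, Nvec_add, Nvec_single]
  ring

lemma Hplus_pos (hnonneg : ∀ i j, 0 ≤ R i j) (hcol : ∀ j, 0 < ∑ i, R i j) (j : Fin d)
    {S : Fin d → ℝ} (hS : ∀ i, 1 ≤ S i) : 0 < Hplus R S := by
  have h1 : ∑ i, R i j ≤ Hfun R S := by
    refine Finset.sum_le_sum fun i _ => ?_
    have hterm : ∀ k, 0 ≤ R i k * S i * S k := fun k =>
      mul_nonneg (mul_nonneg (hnonneg i k) (by linarith [hS i])) (by linarith [hS k])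
    refine le_trans ?_ (Finset.single_le_sum (fun k _ => hterm k) (Finset.mem_univ j))
    have : 1 ≤ S i * S j := one_le_mul_of_one_le_of_one_le (hS i) (hS j)
    nlinarith [hnonneg i j]
  have h2 : 0 ≤ ∑ i, R i i * S i :=
    Finset.sum_nonneg fun i _ => mul_nonneg (hnonneg i i) (by linarith [hS i])
  linarith [hcol j, Hplus.eq_1 R S]

lemma Hplus_le (hnonneg : ∀ i j, 0 ≤ R i j) {S : Fin d → ℝ} (hS : ∀ i, 1 ≤ S i) :
    Hplus R S ≤ Hfun R S + (∑ i, R i i) * ∑ i, S i := by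
  rw [Hplus, Finset.sum_mul]
  gcongr with i
  · exact hnonneg i i
  · exact Finset.single_le_sum (fun k _ => by linarith [hS k]) (Finset.mem_univ i)

lemma three_sub_div_le {c X m y : ℝ} (hc : 0 < c) (hX : 0 < X) (hm : 0 < m) (hy : 0 < y) :
    (3 - y) / m ≤ c / X + X / (c * m ^ 2 * y) := by
  obtain ⟨s, hs, rfl⟩ : ∃ s : ℝ, 0 < s ∧ y = s ^ 2 :=
    ⟨√y, Real.sqrt_pos.2 hy, (Real.sq_sqrt hy.le).symm⟩
  have h1 : (3 - s ^ 2) / m ≤ 2 / (m * s) := by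
    rw [div_le_div_iff₀ hm (by positivity)]
    nlinarith [mul_nonneg (mul_nonneg hm.le (sq_nonneg (s - 1))) (by linarith : 0 ≤ s + 2)]
  have h2 : c / X + X / (c * m ^ 2 * s ^ 2) - 2 / (m * s)
      = (c * m * s - X) ^ 2 / (X * c * m ^ 2 * s ^ 2) := by
    field_simp
    ring
  have h3 : 0 ≤ (c * m * s - X) ^ 2 / (X * c * m ^ 2 * s ^ 2) := by positivity
  linarith

/-- One-step increase of the logarithmic part of the potential. -/
lemma potential_step (hsymm : R.IsSymm) (hnonneg : ∀ i j, 0 ≤ R i j) (hcol : ∀ j, 0 < ∑ i, R i j)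
    {c : ℝ} (hc : 0 < c) {S : Fin d → ℝ} (hS : ∀ i, 1 ≤ S i) (j : Fin d) {n : ℝ} (hn : 1 ≤ n)
    (hsum : ∑ i, S i = n) :
    (c - Hfun R ((n + 1)⁻¹ • (S + Pi.single j 1))) / (c * (n + 1))
        - ((∑ i, R i i) / c + 2) * (1 / n - 1 / (n + 1))
      ≤ c / Nvec R (S + Pi.single j 1) j
        + (Real.log (Hplus R (S + Pi.single j 1)) - Real.log (Hplus R S)) / 2
        - 2 * (Real.log (n + 1) - Real.log n) := by
  have hstep := Hplus_add_single hsymm S j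
  have hS' : ∀ i, 1 ≤ (S + Pi.single j 1 : Fin d → ℝ) i := fun i => by
    have : 0 ≤ (Pi.single j 1 : Fin d → ℝ) i := by
      rw [Pi.single_apply]; split_ifs <;> norm_num
    simpa using add_le_add (hS i) this
  have hsum' : ∑ i, (S + Pi.single j 1 : Fin d → ℝ) i = n + 1 := by
    simp [Finset.sum_add_distrib, hsum, Pi.single_apply]
  have hHS := Hplus_pos hnonneg hcol j hS
  have hHS' := Hplus_pos hnonneg hcol j hS'
  have hle := Hplus_le hnonneg hS'
  have hX : 0 < Nvec R (S + Pi.single j 1) j :=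
    (hcol j).trans_le (sum_col_le_Nvec hsymm hnonneg hS' j)
  have hr : 0 ≤ ∑ i, R i i := Finset.sum_nonneg fun i _ => hnonneg i i
  rw [hsum'] at hle
  generalize S + Pi.single j 1 = S' at *
  generalize ∑ i, R i i = r at *
  have hm : 0 < n + 1 := by linarith
  have hn0 : 0 < n := by linarith
  have hlogH : 2 * Nvec R S' j / Hplus R S' ≤ Real.log (Hplus R S') - Real.log (Hplus R S) := by
    have h := Real.log_le_sub_one_of_pos (div_pos hHS hHS')
    rw [Real.log_div hHS.ne' hHS'.ne'] at h
    have : Hplus R S / Hplus R S' - 1 = -(2 * Nvec R S' j / Hplus R S') := by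
      rw [eq_sub_of_add_eq hstep.symm]
      field_simp
      ring
    linarith
  have hlogn : Real.log (n + 1) - Real.log n ≤ 1 / n := by
    have h := Real.log_le_sub_one_of_pos (div_pos hm hn0)
    rw [Real.log_div hm.ne' hn0.ne'] at h
    have : (n + 1) / n - 1 = 1 / n := by field_simp; ring
    linarith
  have hAM := three_sub_div_le hc hX hm (y := Hplus R S' / (c * (n + 1) ^ 2)) (by positivity)
  rw [mul_div_cancel₀ _ (by positivity : c * (n + 1) ^ 2 ≠ 0)] at hAM
  have hy : Hplus R S' / (c * (n + 1) ^ 2) ≤ Hfun R ((n + 1)⁻¹ • S') / c + r / (c * (n + 1)) := by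
    rw [Hfun_smul, div_le_iff₀ (by positivity)]
    refine hle.trans (le_of_eq ?_)
    field_simp
  have hmain : (3 - (Hfun R ((n + 1)⁻¹ • S') / c + r / (c * (n + 1)))) / (n + 1)
      ≤ c / Nvec R S' j + Nvec R S' j / Hplus R S' := by
    refine le_trans ?_ hAM
    gcongr
  have hhalf : 2 * Nvec R S' j / Hplus R S' = 2 * (Nvec R S' j / Hplus R S') := by ring
  have herr : r / c * (1 / (n + 1) ^ 2) ≤ r / c * (1 / n - 1 / (n + 1)) := by
    have : 1 / (n + 1) ^ 2 ≤ 1 / n - 1 / (n + 1) := by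
      rw [div_sub_div _ _ hn0.ne' hm.ne', div_le_div_iff₀ (by positivity) (by positivity)]
      nlinarith
    gcongr
  have hid : (3 - (Hfun R ((n + 1)⁻¹ • S') / c + r / (c * (n + 1)))) / (n + 1)
      = (c - Hfun R ((n + 1)⁻¹ • S')) / (c * (n + 1)) + 2 * (1 / (n + 1))
        - r / c * (1 / (n + 1) ^ 2) := by
    field_simp
    ring
  linarith

variable {Ω : Type*} {Y : ℕ → Ω → Fin d} {n : ℕ} {ω : Ω}

lemma one_le_visits (Y : ℕ → Ω → Fin d) (n : ℕ) (ω : Ω) (i : Fin d) : 1 ≤ visits Y n ω i := by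
  simp [visits]

lemma card_visits_succ (hn : d ≤ n) (i : Fin d) :
    ((Finset.Ioc d (n + 1)).filter fun m => Y m ω = i).card
      = ((Finset.Ioc d n).filter fun m => Y m ω = i).card + if Y (n + 1) ω = i then 1 else 0 := by
  rw [Finset.card_filter, Finset.sum_Ioc_succ_top (by lia), ← Finset.card_filter]

lemma visits_succ (hn : d ≤ n) :
    visits Y (n + 1) ω = visits Y n ω + Pi.single (Y (n + 1) ω) 1 := by
  ext i
  simp only [visits, card_visits_succ hn, Pi.add_apply, Pi.single_apply, @eq_comm _ i]
  push_cast
  ring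

lemma sum_visits (hn : d ≤ n) : ∑ i, visits Y n ω i = n := by
  induction n, hn using Nat.le_induction with
  | base => simp [visits]
  | succ n hn ih =>
    rw [visits_succ hn]
    simp [Finset.sum_add_distrib, ih, Pi.single_apply]

lemma occup_eq_smul (Y : ℕ → Ω → Fin d) (n : ℕ) (ω : Ω) :
    occup Y n ω = (n : ℝ)⁻¹ • visits Y n ω := by
  ext i
  simp [occup, div_eq_inv_mul]

lemma occup_mem_simplex (hd : 0 < d) (hn : d ≤ n) : occup Y n ω ∈ simplex d := by
  refine ⟨fun i => div_nonneg (by linarith [one_le_visits Y n ω i]) n.cast_nonneg, ?_⟩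
  have : (n : ℝ) ≠ 0 := by
    norm_cast
    lia
  simp only [occup, ← Finset.sum_div, sum_visits hn, div_self this]

lemma abs_occup_succ_sub_le (hd : 0 < d) (hn : d ≤ n) (i : Fin d) :
    |occup Y (n + 1) ω i - occup Y n ω i| ≤ 1 / (n + 1) := by
  have hs : (Pi.single (Y (n + 1) ω) 1 : Fin d → ℝ) i ∈ Set.Icc 0 1 := by
    rw [Pi.single_apply]
    split_ifs <;> simp
  have hv := occup_mem_simplex (Y := Y) (ω := ω) hd hn
  have h0 := hv.1 i
  have h1 : occup Y n ω i ≤ 1 :=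
    hv.2 ▸ Finset.single_le_sum (fun k _ => hv.1 k) (Finset.mem_univ i)
  have hn0 : (0 : ℝ) < n := by
    norm_cast
    lia
  have hstep : occup Y (n + 1) ω i - occup Y n ω i
      = ((Pi.single (Y (n + 1) ω) 1 : Fin d → ℝ) i - occup Y n ω i) / (n + 1) := by
    simp only [occup, visits_succ hn, Pi.add_apply]
    push_cast
    field_simp
    ring
  rw [hstep, abs_div, abs_of_pos (by positivity : (0 : ℝ) < n + 1)]
  gcongr
  exact abs_le.2 ⟨by linarith [hs.1], by linarith [hs.2]⟩

lemma abs_Hfun_sub_le (hnonneg : ∀ i j, 0 ≤ R i j) {v w : Fin d → ℝ} (hv : v ∈ simplex d)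
    (hw : w ∈ simplex d) {ε : ℝ} (h : ∀ i, |v i - w i| ≤ ε) :
    |Hfun R v - Hfun R w| ≤ 2 * (∑ i, ∑ j, R i j) * ε := by
  have hle {z : Fin d → ℝ} (hz : z ∈ simplex d) (i : Fin d) : |z i| ≤ 1 := by
    rw [abs_of_nonneg (hz.1 i)]
    exact hz.2 ▸ Finset.single_le_sum (fun k _ => hz.1 k) (Finset.mem_univ i)
  simp only [Hfun, ← Finset.sum_sub_distrib, Finset.mul_sum, Finset.sum_mul]
  refine (Finset.abs_sum_le_sum_abs _ _).trans (Finset.sum_le_sum fun i _ => ?_)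
  refine (Finset.abs_sum_le_sum_abs _ _).trans (Finset.sum_le_sum fun j _ => ?_)
  have hid : R i j * v i * v j - R i j * w i * w j
      = R i j * ((v i - w i) * v j + w i * (v j - w j)) := by ring
  rw [hid, abs_mul, abs_of_nonneg (hnonneg i j)]
  have h1 : |(v i - w i) * v j| ≤ ε * 1 := by
    rw [abs_mul]
    exact mul_le_mul (h i) (hle hv j) (abs_nonneg _) ((abs_nonneg _).trans (h i))
  have h2 : |w i * (v j - w j)| ≤ 1 * ε := by
    rw [abs_mul]
    exact mul_le_mul (hle hw i) (h j) (abs_nonneg _) zero_le_one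
  have := mul_le_mul_of_nonneg_left ((abs_add_le _ _).trans (add_le_add h1 h2)) (hnonneg i j)
  linarith

/-- The potential whose drift along the walk controls `H p - H (V n)`: a discrete version of
`∑ pᵢ log Sᵢ + log H(S) / 2 - 2 log n` with lower order corrections. -/
noncomputable def potential (R : Matrix (Fin d) (Fin d) ℝ) (p : Fin d → ℝ) (Y : ℕ → Ω → Fin d)
    (n : ℕ) (ω : Ω) : ℝ :=
  ∑ i, p i * (harmonic ((Finset.Ioc d n).filter fun m => Y m ω = i).card : ℝ)
    + Hfun R p / Nvec R (visits Y n ω) (Y n ω)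
    + Real.log (Hplus R (visits Y n ω)) / 2 - 2 * Real.log n
    - ((∑ i, R i i) / Hfun R p + 2) / n

/-- The martingale part of the increments of `potential`. -/
noncomputable def noise (R : Matrix (Fin d) (Fin d) ℝ) (p : Fin d → ℝ) (Y : ℕ → Ω → Fin d)
    (n : ℕ) (ω : Ω) : ℝ :=
  p (Y (n + 1) ω) / visits Y n ω (Y (n + 1) ω) - Hfun R p / Nvec R (visits Y n ω) (Y n ω)

lemma noise_add_le_potential_sub (hsymm : R.IsSymm) (hnonneg : ∀ i j, 0 ≤ R i j)
    (hcol : ∀ j, 0 < ∑ i, R i j) {p : Fin d → ℝ} (hp : 0 < Hfun R p) (hd : 0 < d) (hn : d ≤ n) :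
    noise R p Y n ω + (Hfun R p - Hfun R (occup Y (n + 1) ω)) / (Hfun R p * (n + 1))
      ≤ potential R p Y (n + 1) ω - potential R p Y n ω := by
  have h1 : (1 : ℝ) ≤ n := by
    norm_cast
    lia
  have hharm : ∑ i, p i * (harmonic ((Finset.Ioc d (n + 1)).filter fun m => Y m ω = i).card : ℝ)
      = ∑ i, p i * (harmonic ((Finset.Ioc d n).filter fun m => Y m ω = i).card : ℝ)
        + p (Y (n + 1) ω) / visits Y n ω (Y (n + 1) ω) := by
    have hterm : ∀ i, p i * (harmonic ((Finset.Ioc d (n + 1)).filter fun m => Y m ω = i).card : ℝ)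
        = p i * (harmonic ((Finset.Ioc d n).filter fun m => Y m ω = i).card : ℝ)
          + if Y (n + 1) ω = i then p i / visits Y n ω i else 0 := fun i => by
      rw [card_visits_succ hn]
      split_ifs
      · rw [harmonic_succ, visits]
        push_cast
        ring
      · simp
    simp only [hterm, Finset.sum_add_distrib, Finset.sum_ite_eq, Finset.mem_univ, if_true]
  have h := potential_step hsymm hnonneg hcol hp (one_le_visits Y n ω) (Y (n + 1) ω) h1
    (sum_visits hn)
  rw [potential, potential, noise, hharm, occup_eq_smul, visits_succ hn]
  push_cast
  have hsplit : ∀ E : ℝ, E * (1 / n - 1 / (n + 1)) = E / n - E / (n + 1) := fun E => by ring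
  rw [hsplit] at h
  linarith

lemma potential_le (hsymm : R.IsSymm) (hnonneg : ∀ i j, 0 ≤ R i j)
    (hcol : ∀ j, 0 < ∑ i, R i j) {p : Fin d → ℝ} (hp : 0 < Hfun R p) (hps : p ∈ simplex d)
    (hmax : ∀ v ∈ simplex d, Hfun R v ≤ Hfun R p) (hd : 0 < d) (hn : d ≤ n) :
    potential R p Y n ω ≤ 1 + ∑ i, Hfun R p / ∑ j, R j i
      + Real.log (Hfun R p + ∑ i, R i i) / 2 := by
  have h1 : (1 : ℝ) ≤ n := by
    norm_cast
    lia
  have hr : 0 ≤ ∑ i, R i i := Finset.sum_nonneg fun i _ => hnonneg i i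
  have hharm : ∑ i, p i * (harmonic ((Finset.Ioc d n).filter fun m => Y m ω = i).card : ℝ)
      ≤ 1 + Real.log n := by
    have hterm : ∀ i, (harmonic ((Finset.Ioc d n).filter fun m => Y m ω = i).card : ℝ)
        ≤ 1 + Real.log n := fun i => by
      refine (harmonic_le_one_add_log _).trans ?_
      have hcard : ((Finset.Ioc d n).filter fun m => Y m ω = i).card ≤ n :=
        (Finset.card_filter_le _ _).trans (by simp)
      rcases Nat.eq_zero_or_pos ((Finset.Ioc d n).filter fun m => Y m ω = i).card with h | h
      · simpa [h] using Real.log_nonneg h1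
      · gcongr
    calc _ ≤ ∑ i, p i * (1 + Real.log n) :=
          Finset.sum_le_sum fun i _ => mul_le_mul_of_nonneg_left (hterm i) (hps.1 i)
      _ = 1 + Real.log n := by rw [← Finset.sum_mul, hps.2, one_mul]
  have hk : Hfun R p / Nvec R (visits Y n ω) (Y n ω) ≤ ∑ i, Hfun R p / ∑ j, R j i := by
    refine le_trans ?_ (Finset.single_le_sum
      (fun i _ => div_nonneg hp.le (hcol i).le) (Finset.mem_univ (Y n ω)))
    exact div_le_div_of_nonneg_left hp.le (hcol _)
      (sum_col_le_Nvec hsymm hnonneg (one_le_visits Y n ω) _)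
  have hlog : Real.log (Hplus R (visits Y n ω))
      ≤ Real.log (Hfun R p + ∑ i, R i i) + 2 * Real.log n := by
    have hn0 : (0 : ℝ) < n := by linarith
    have hpos := Hplus_pos hnonneg hcol (Y n ω) (one_le_visits Y n ω)
    have hle := Hplus_le hnonneg (one_le_visits Y n ω)
    have hocc := hmax _ (occup_mem_simplex (Y := Y) (ω := ω) hd hn)
    rw [occup_eq_smul, Hfun_smul, inv_pow, inv_mul_le_iff₀ (by positivity)] at hocc
    rw [sum_visits hn] at hle
    have : Hplus R (visits Y n ω) ≤ (Hfun R p + ∑ i, R i i) * (n : ℝ) ^ 2 := by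
      nlinarith [mul_nonneg hr (mul_nonneg hn0.le (sub_nonneg.2 h1))]
    refine (Real.log_le_log hpos this).trans (le_of_eq ?_)
    rw [Real.log_mul (by positivity) (by positivity), Real.log_pow]
    norm_num
  have herr : 0 ≤ ((∑ i, R i i) / Hfun R p + 2) / (n : ℝ) := by positivity
  rw [potential]
  linarith

lemma exists_potential_eq (hstart : ∀ ω, (Y d ω : ℕ) = 0) (R : Matrix (Fin d) (Fin d) ℝ)
    (p : Fin d → ℝ) : ∃ C, ∀ ω, potential R p Y d ω = C := by
  rcases isEmpty_or_nonempty Ω with h | ⟨⟨ω₀⟩⟩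
  · exact ⟨0, fun ω => h.elim ω⟩
  · refine ⟨potential R p Y d ω₀, fun ω => ?_⟩
    have hY : Y d ω = Y d ω₀ := Fin.ext ((hstart ω).trans (hstart ω₀).symm)
    have hv : visits Y d ω = visits Y d ω₀ := by
      ext i
      simp [visits]
    simp [potential, hY, hv]

lemma measurable_natFilt {m : ℕ} (hm : m ∈ Finset.Icc d n) : Measurable[natFilt Y n] (Y m) := by
  have h : MeasurableSpace.comap (Y m) ⊤ ≤ natFilt Y n :=
    le_iSup₂ (f := fun m (_ : m ∈ Finset.Icc d n) => MeasurableSpace.comap (Y m) ⊤) m hm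
  exact Measurable.mono (comap_measurable (Y m)) h le_rfl

lemma measurable_visits (Y : ℕ → Ω → Fin d) (n : ℕ) (i : Fin d) :
    Measurable[natFilt Y n] fun ω => visits Y n ω i := by
  let _ := natFilt Y n
  simp only [visits, Finset.card_filter, Nat.cast_sum, Nat.cast_ite, Nat.cast_one, Nat.cast_zero]
  refine measurable_const.add (Finset.measurable_fun_sum _ fun m hm => ?_)
  have hm' : m ∈ Finset.Icc d n := Finset.mem_Icc.2 ⟨(Finset.mem_Ioc.1 hm).1.le,
    (Finset.mem_Ioc.1 hm).2⟩
  exact Measurable.ite (measurable_natFilt hm' (measurableSet_singleton i))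
    measurable_const measurable_const

variable [MeasurableSpace Ω] {μ : Measure Ω}

lemma natFilt_le (hY : ∀ n, Measurable (Y n)) (n : ℕ) : natFilt Y n ≤ ‹MeasurableSpace Ω› :=
  iSup₂_le fun m _ => (hY m).comap_le

lemma integrable_and_integral_noise [IsProbabilityMeasure μ] {p : Fin d → ℝ}
    (hN : ∀ i, Nvec R p i = Hfun R p) (hY : IsVRRW μ R Y) (hn : d ≤ n) :
    Integrable (noise R p Y n) μ ∧ ∫ ω, noise R p Y n ω ∂μ = 0 := by
  obtain ⟨hmeas, -, htrans⟩ := hY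
  have hle := natFilt_le hmeas n
  let ind : Fin d → Ω → ℝ := fun j ω => if Y (n + 1) ω = j then 1 else 0
  let g : Fin d → Ω → ℝ := fun j ω => p j / visits Y n ω j
  have hgm : ∀ j, Measurable[natFilt Y n] (g j) := fun j => by
    let _ := natFilt Y n
    exact measurable_const.div (measurable_visits Y n j)
  have hindm : ∀ j, Measurable (ind j) := fun j =>
    Measurable.ite (hmeas (n + 1) (measurableSet_singleton j)) measurable_const measurable_const
  have hindb : ∀ j ω, ‖ind j ω‖ ≤ 1 := fun j ω => by
    simp only [ind]
    split_ifs <;> simp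
  have hgb : ∀ j ω, ‖g j ω‖ ≤ |p j| := fun j ω => by
    have := one_le_visits Y n ω j
    rw [Real.norm_eq_abs, abs_div, abs_of_pos (by linarith : 0 < visits Y n ω j)]
    exact div_le_self (abs_nonneg _) this
  have hindi : ∀ j, Integrable (ind j) μ := fun j =>
    Integrable.of_bound (hindm j).aestronglyMeasurable 1 (ae_of_all _ (hindb j))
  have higi : ∀ j, Integrable (ind j * g j) μ := fun j => by
    refine Integrable.of_bound ((hindm j).mul ((hgm j).mono hle le_rfl)).aestronglyMeasurable
      (1 * |p j|) (ae_of_all _ fun ω => ?_)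
    rw [Pi.mul_apply, norm_mul]
    exact mul_le_mul (hindb j ω) (hgb j ω) (norm_nonneg _) zero_le_one
  have hcond : ∀ j, μ[ind j * g j | natFilt Y n] =ᵐ[μ]
      fun ω => R (Y n ω) j * p j / Nvec R (visits Y n ω) (Y n ω) := fun j => by
    filter_upwards [condExp_mul_of_stronglyMeasurable_right (hgm j).stronglyMeasurable (higi j)
      (hindi j), htrans n hn j] with ω h1 h2
    have hvj : visits Y n ω j ≠ 0 := by linarith [one_le_visits Y n ω j]
    rw [h1, Pi.mul_apply, h2]
    simp only [g, Nvec]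
    field_simp
  have hκi : ∀ j, Integrable
      (fun ω => R (Y n ω) j * p j / Nvec R (visits Y n ω) (Y n ω)) μ := fun j =>
    integrable_condExp.congr (hcond j)
  have hκ : ∀ ω, Hfun R p / Nvec R (visits Y n ω) (Y n ω)
      = ∑ j, R (Y n ω) j * p j / Nvec R (visits Y n ω) (Y n ω) := fun ω => by
    rw [← Finset.sum_div, ← hN (Y n ω), Nvec]
  have hnoise : noise R p Y n = fun ω => ∑ j, (ind j * g j) ω
      - ∑ j, R (Y n ω) j * p j / Nvec R (visits Y n ω) (Y n ω) := by
    ext ω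
    rw [noise, hκ]
    simp [ind, g]
  have hs1 : Integrable (fun ω => ∑ j, (ind j * g j) ω) μ := integrable_finsetSum _ fun j _ => higi j
  have hs2 : Integrable
      (fun ω => ∑ j, R (Y n ω) j * p j / Nvec R (visits Y n ω) (Y n ω)) μ :=
    integrable_finsetSum _ fun j _ => hκi j
  rw [hnoise]
  refine ⟨hs1.sub hs2, ?_⟩
  rw [integral_sub hs1 hs2, integral_finsetSum _ fun j _ => higi j,
    integral_finsetSum _ fun j _ => hκi j, sub_eq_zero]
  refine Finset.sum_congr rfl fun j _ => ?_
  rw [← integral_congr_ae (hcond j), integral_condExp hle]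

lemma ae_summable [IsProbabilityMeasure μ] (hsymm : R.IsSymm)
    (hnonneg : ∀ i j, 0 ≤ R i j) (hcol : ∀ j, 0 < ∑ i, R i j) {p : Fin d → ℝ}
    (hp : 0 < Hfun R p) (hps : p ∈ simplex d) (hN : ∀ i, Nvec R p i = Hfun R p)
    (hmax : ∀ v ∈ simplex d, Hfun R v ≤ Hfun R p) (hd : 0 < d) (hY : IsVRRW μ R Y) :
    ∀ᵐ ω ∂μ, Summable fun k : ℕ =>
      (Hfun R p - Hfun R (occup Y (d + k + 1) ω)) / (Hfun R p * ((d + k : ℕ) + 1)) := by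
  let f : ℕ → Ω → ℝ := fun k ω =>
    (Hfun R p - Hfun R (occup Y (d + k + 1) ω)) / (Hfun R p * ((d + k : ℕ) + 1))
  have hf0 : ∀ k ω, 0 ≤ f k ω := fun k ω =>
    div_nonneg (sub_nonneg.2 (hmax _ (occup_mem_simplex hd (by lia)))) (by positivity)
  have hfm : ∀ k, Measurable (f k) := fun k => by
    have hocc : Measurable (occup Y (d + k + 1)) := measurable_pi_iff.2 fun i =>
      ((measurable_visits Y _ i).mono (natFilt_le hY.1 _) le_rfl).div_const _
    exact (measurable_const.sub (continuous_Hfun.measurable.comp hocc)).div_const _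
  obtain ⟨P, hP⟩ := exists_potential_eq (Y := Y) hY.2.1 R p
  have hnoise := fun k : ℕ =>
    integrable_and_integral_noise hN hY (Nat.le_add_right d k)
  obtain ⟨B, hB⟩ : ∃ B, ∀ N ω, potential R p Y (d + N) ω ≤ B :=
    ⟨_, fun N ω => potential_le hsymm hnonneg hcol hp hps hmax hd (Nat.le_add_right d N)⟩
  have hsum : ∀ N ω, ∑ k ∈ Finset.range N, f k ω
      ≤ (B - P) - ∑ k ∈ Finset.range N, noise R p Y (d + k) ω := fun N ω => by
    have htel : ∑ k ∈ Finset.range N, (noise R p Y (d + k) ω + f k ω)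
        ≤ potential R p Y (d + N) ω - potential R p Y d ω := by
      refine le_trans ?_ (Finset.sum_range_sub (fun k => potential R p Y (d + k) ω) N).le
      exact Finset.sum_le_sum fun k _ =>
        noise_add_le_potential_sub hsymm hnonneg hcol hp hd (Nat.le_add_right d k)
    rw [Finset.sum_add_distrib, hP] at htel
    linarith [hB N ω]
  have hlint : ∫⁻ ω, ∑' k, ENNReal.ofReal (f k ω) ∂μ ≤ ENNReal.ofReal (B - P) := by
    rw [lintegral_tsum fun k => (hfm k).ennreal_ofReal.aemeasurable]
    refine ENNReal.tsum_le_of_sum_range_le fun N => ?_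
    have hint : Integrable (fun ω => ∑ k ∈ Finset.range N, noise R p Y (d + k) ω) μ :=
      integrable_finsetSum _ fun k _ => (hnoise k).1
    calc ∑ k ∈ Finset.range N, ∫⁻ ω, ENNReal.ofReal (f k ω) ∂μ
        = ∫⁻ ω, ENNReal.ofReal (∑ k ∈ Finset.range N, f k ω) ∂μ := by
          rw [← lintegral_finsetSum _ fun k _ => (hfm k).ennreal_ofReal]
          exact lintegral_congr fun ω => (ENNReal.ofReal_sum_of_nonneg fun k _ => hf0 k ω).symm
      _ ≤ ∫⁻ ω, ENNReal.ofReal ((B - P) - ∑ k ∈ Finset.range N, noise R p Y (d + k) ω) ∂μ :=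
          lintegral_mono fun ω => ENNReal.ofReal_le_ofReal (hsum N ω)
      _ = ENNReal.ofReal (∫ ω, ((B - P) - ∑ k ∈ Finset.range N, noise R p Y (d + k) ω) ∂μ) :=
          (ofReal_integral_eq_lintegral_ofReal ((integrable_const _).sub hint)
            (ae_of_all _ fun ω => (Finset.sum_nonneg fun k _ => hf0 k ω).trans (hsum N ω))).symm
      _ = ENNReal.ofReal (B - P) := by
          rw [integral_sub (integrable_const _) hint, integral_finsetSum _ fun k _ => (hnoise k).1,
            Finset.sum_eq_zero fun k _ => (hnoise k).2]
          simp
  filter_upwards [ae_lt_top (Measurable.tsum fun k => (hfm k).ennreal_ofReal)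
    (hlint.trans_lt ENNReal.ofReal_lt_top).ne] with ω hω
  refine (ENNReal.summable_toReal hω.ne).congr fun k => ?_
  exact ENNReal.toReal_ofReal (hf0 k ω)

/-- If `H` has a unique maximiser on the simplex, at which `Nvec` is constant, then the occupation
measure of the walk converges to it almost surely. -/
lemma ae_tendsto_occup [IsProbabilityMeasure μ] (hsymm : R.IsSymm)
    (hnonneg : ∀ i j, 0 ≤ R i j) (hcol : ∀ j, 0 < ∑ i, R i j) {p : Fin d → ℝ}
    (hp : 0 < Hfun R p) (hps : p ∈ simplex d) (hN : ∀ i, Nvec R p i = Hfun R p)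
    (hmax : ∀ v ∈ simplex d, v ≠ p → Hfun R v < Hfun R p) (hd : 0 < d) (hY : IsVRRW μ R Y) :
    ∀ᵐ ω ∂μ, Tendsto (fun n => occup Y n ω) atTop (nhds p) := by
  have hmax' : ∀ v ∈ simplex d, Hfun R v ≤ Hfun R p := fun v hv => by
    rcases eq_or_ne v p with rfl | h
    · exact le_rfl
    · exact (hmax v hv h).le
  filter_upwards [ae_summable hsymm hnonneg hcol hp hps hN hmax' hd hY] with ω hω
  have hocc : ∀ k, occup Y (d + k + 1) ω ∈ simplex d := fun k => occup_mem_simplex hd (by lia)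
  have hw : ¬ Summable fun k : ℕ => 1 / (((d + k : ℕ) : ℝ) + 1) := by
    have h := mt (summable_nat_add_iff (f := fun n : ℕ => 1 / (n : ℝ)) (d + 1)).1
      Real.not_summable_one_div_natCast
    refine fun hs => h (hs.congr fun k => ?_)
    push_cast
    ring
  have hw2 : Summable fun k : ℕ => (1 / (((d + k : ℕ) : ℝ) + 1)) ^ 2 := by
    have h := (summable_nat_add_iff (f := fun n : ℕ => 1 / (n : ℝ) ^ 2) (d + 1)).2
      (Real.summable_one_div_nat_pow.2 one_lt_two)
    refine h.congr fun k => ?_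
    rw [one_div_pow]
    push_cast
    ring
  have hgap : Tendsto (fun k => Hfun R p - Hfun R (occup Y (d + k + 1) ω)) atTop (nhds 0) := by
    refine tendsto_zero_of_summable_mul (w := fun k : ℕ => 1 / (((d + k : ℕ) : ℝ) + 1))
      (K := 2 * ∑ i, ∑ j, R i j) (fun k => sub_nonneg.2 (hmax' _ (hocc k)))
      (fun k => by positivity) (fun k => ?_) ?_ hw2 hw
    · rw [sub_sub_sub_cancel_left, abs_sub_comm]
      refine abs_Hfun_sub_le hnonneg (hocc (k + 1)) (hocc k) fun i => ?_
      refine (abs_occup_succ_sub_le hd (by lia) i).trans ?_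
      push_cast
      gcongr
      linarith
    · refine (hω.mul_left (Hfun R p)).congr fun k => ?_
      field_simp
  have hlim : Tendsto (fun k => Hfun R (occup Y (d + k + 1) ω)) atTop (nhds (Hfun R p)) := by
    simpa using (tendsto_const_nhds (x := Hfun R p)).sub hgap
  have h := tendsto_of_tendsto_Hfun hmax (Eventually.of_forall hocc) hlim
  refine (tendsto_add_atTop_iff_nat (d + 1)).1 (h.congr fun k => ?_)
  rw [show k + (d + 1) = d + k + 1 by ring]

end VRRW

/-- If `A` is a connected component of `C` disjoint from `C₀` which is a
local maximum for `H`, then `P(dist(V(n), A) → 0) > 0`. -/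
theorem stmt3 {d : ℕ} (hd : 2 ≤ d) (R : Matrix (Fin d) (Fin d) ℝ)
    (hsymm : R.IsSymm) (hnonneg : ∀ i j, 0 ≤ R i j) (hcol : ∀ j, 0 < ∑ i, R i j)
    (A : Set (Fin d → ℝ)) (x : Fin d → ℝ) (hx : x ∈ critSet R)
    (hA : A = connectedComponentIn (critSet R) x)
    (hdisj : A ∩ degenSet R = ∅)
    (𝒩 : Set (Fin d → ℝ)) (hopen : ∃ U : Set (Fin d → ℝ), IsOpen U ∧ 𝒩 = U ∩ simplex d)
    (hsub : A ⊆ 𝒩)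
    (hmax : ∀ v ∈ 𝒩 \ A, ∀ p ∈ A, Hfun R v < Hfun R p)
    {Ω : Type} [MeasurableSpace Ω] (μ : Measure Ω) [IsProbabilityMeasure μ]
    (Y : ℕ → Ω → Fin d) (hY : IsVRRW μ R Y) :
    0 < μ {ω | Tendsto (fun n => distToSet (occup Y n ω) A) atTop (nhds 0)} := by
  have hxA : x ∈ A := hA ▸ mem_connectedComponentIn hx
  have hpos : ∀ i, 0 < x i := fun i => by
    refine (hx.1.1 i).lt_of_ne fun h => ?_
    exact Set.eq_empty_iff_forall_notMem.1 hdisj x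
      ⟨hxA, mem_degenSet_of_coord_eq_zero hx.1 h.symm⟩
  have hN := Nvec_eq_Hfun_of_mem_critSet hx hpos
  have hlt : ∀ v ∈ simplex d, v ≠ x → Hfun R v < Hfun R x := fun v hv hne => by
    have hsum : ∑ i, (v - x) i = 0 := by
      simp [Finset.sum_sub_distrib, hv.2, hx.1.2]
    have hneg := Hfun_neg_of_sum_eq_zero hsymm hx hA hdisj hopen hsub hmax hpos hsum
      (sub_ne_zero.2 hne)
    have h := Hfun_add hsymm x (v - x)
    simp only [hN, ← Finset.sum_mul, hsum, add_sub_cancel] at h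
    linarith
  have hae : ∀ᵐ ω ∂μ, Tendsto (fun n => distToSet (occup Y n ω) A) atTop (nhds 0) := by
    filter_upwards [ae_tendsto_occup hsymm hnonneg hcol hx.2.1 hx.1 hN hlt (by lia) hY] with ω hω
    exact tendsto_distToSet hxA hω
  rw [measure_congr (eventuallyEq_univ.2 hae), measure_univ]
  exact zero_lt_one
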